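/- arXiv:1808.09475 — 5 statements merged into one kernel-verified Lean document; each statement's English description precedes it below -/
import Mathlib

section
/- If m ≥ 3, n ≥ 1 are integers with m ≠ 2n, then the treewidth of the stacked prism graph Y_{m,n} equals min{m, 2n}. -/
open SimpleGraph

/-- A tree decomposition of a graph `G`: a tree `tree` on node type `ι` with a bag of
vertices of `G` at each node, such that every vertex lies in some bag, both endpoints of
every edge lie in a common bag, and for each vertex the set of nodes whose bags contain it
induces a connected subgraph of the tree. -/
structure TreeDecomp {V : Type*} (G : SimpleGraph V) where
  ι : Type
  tree : SimpleGraph ι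
  isTree : tree.IsTree
  bag : ι → Set V
  bag_cover : ∀ v : V, ∃ t, v ∈ bag t
  bag_edge : ∀ ⦃u v : V⦄, G.Adj u v → ∃ t, u ∈ bag t ∧ v ∈ bag t
  bag_conn : ∀ v : V, (tree.induce {t | v ∈ bag t}).Connected

/-- The treewidth of `G`: the least `k` such that some tree decomposition of `G` has all
bags of size at most `k + 1` (i.e. the minimum over tree decompositions of one less than
the maximum bag size). -/
noncomputable def treewidth {V : Type*} (G : SimpleGraph V) : ℕ :=
  sInf {k : ℕ | ∃ D : TreeDecomp G, ∀ t, (D.bag t).ncard ≤ k + 1}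

/-- Two vertex sets touch if their union induces a connected subgraph. -/
def Touches {V : Type*} (G : SimpleGraph V) (A B : Set V) : Prop :=
  (G.induce (A ∪ B)).Connected

/-- A bramble: a family of vertex sets, each inducing a connected subgraph,
that pairwise touch. -/
structure IsBramble {V : Type*} (G : SimpleGraph V) (ℬ : Set (Set V)) : Prop where
  conn : ∀ B ∈ ℬ, (G.induce B).Connected
  touch : ∀ A ∈ ℬ, ∀ B ∈ ℬ, Touches G A B

/-- A strict bramble: a bramble any two of whose members share a vertex. -/
def IsStrictBramble {V : Type*} (G : SimpleGraph V) (ℬ : Set (Set V)) : Prop :=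
  IsBramble G ℬ ∧ ∀ A ∈ ℬ, ∀ B ∈ ℬ, (A ∩ B).Nonempty

/-- A hitting set for a family of vertex sets: a set meeting every member. -/
def IsHittingSet {V : Type*} (ℬ : Set (Set V)) (S : Set V) : Prop :=
  ∀ B ∈ ℬ, (S ∩ B).Nonempty

/-- The order of a bramble: the minimum size of a hitting set. -/
noncomputable def brambleOrder {V : Type*} (ℬ : Set (Set V)) : ℕ :=
  sInf {k : ℕ | ∃ S : Set V, IsHittingSet ℬ S ∧ S.ncard = k}

/-- The bramble number of `G`: the maximum order of a bramble on `G`. -/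
noncomputable def brambleNumber {V : Type*} (G : SimpleGraph V) : ℕ :=
  sSup {k : ℕ | ∃ ℬ, IsBramble G ℬ ∧ brambleOrder ℬ = k}

/-- The strict bramble number of `G`: the maximum order of a strict bramble on `G`. -/
noncomputable def strictBrambleNumber {V : Type*} (G : SimpleGraph V) : ℕ :=
  sSup {k : ℕ | ∃ ℬ, IsStrictBramble G ℬ ∧ brambleOrder ℬ = k}

/-- The `m × n` grid graph `P_m □ P_n`. -/
def gridGraph (m n : ℕ) : SimpleGraph (Fin m × Fin n) :=
  SimpleGraph.pathGraph m □ SimpleGraph.pathGraph n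

/-- The stacked prism graph `Y_{m,n} = C_m □ P_n`. -/
def stackedPrism (m n : ℕ) : SimpleGraph (Fin m × Fin n) :=
  SimpleGraph.cycleGraph m □ SimpleGraph.pathGraph n

/-- The toroidal grid graph `T_{m,n} = C_m □ C_n`. -/
def toroidalGrid (m n : ℕ) : SimpleGraph (Fin m × Fin n) :=
  SimpleGraph.cycleGraph m □ SimpleGraph.cycleGraph n

/-- `H` is a minor of `G`: there are pairwise disjoint nonempty connected branch sets in `G`,
one for each vertex of `H`, with an edge of `G` between the branch sets of any two vertices
adjacent in `H`. -/
def IsGraphMinor {W V : Type*} (H : SimpleGraph W) (G : SimpleGraph V) : Prop :=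
  ∃ B : W → Set V,
    (∀ w, (B w).Nonempty) ∧
    (∀ w, (G.induce (B w)).Connected) ∧
    (∀ w₁ w₂, w₁ ≠ w₂ → Disjoint (B w₁) (B w₂)) ∧
    (∀ ⦃w₁ w₂⦄, H.Adj w₁ w₂ → ∃ v₁ ∈ B w₁, ∃ v₂ ∈ B w₂, G.Adj v₁ v₂)

open Classical in
/-- The chip-firing move at a vertex `v`: `v` loses one chip along each incident edge,
each neighbor of `v` gains one chip. -/
noncomputable def fireVertex {V : Type*} (G : SimpleGraph V) (D : V → ℤ) (v : V) : V → ℤ :=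
  fun u => if u = v then D u - (G.neighborSet v).ncard
    else if G.Adj v u then D u + 1 else D u

/-- Two divisors on `G` are equivalent if one is obtained from the other by a finite
sequence of chip-firing moves. -/
def ChipEquiv {V : Type*} (G : SimpleGraph V) : (V → ℤ) → (V → ℤ) → Prop :=
  Relation.EqvGen (fun D D' => ∃ v, D' = fireVertex G D v)

/-- A divisor `D` wins the gonality game on `G` if for every vertex `q`, the divisor
`D - q` is equivalent to an effective divisor. -/
def WinsGonalityGame {V : Type*} [DecidableEq V] (G : SimpleGraph V) (D : V → ℤ) : Prop :=
  ∀ q : V, ∃ E : V → ℤ, (∀ v, 0 ≤ E v) ∧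
    ChipEquiv G (fun v => D v - if v = q then 1 else 0) E

/-- The divisorial gonality of `G`: the least degree of an effective divisor winning the
gonality game. -/
noncomputable def gonality {V : Type*} [Fintype V] [DecidableEq V] (G : SimpleGraph V) : ℕ :=
  sInf {k : ℕ | ∃ D : V → ℤ, (∀ v, 0 ≤ D v) ∧ (∑ v, D v) = (k : ℤ) ∧ WinsGonalityGame G D}

/-- A vertex reachable from a member of an adjacency-closed set is a member. -/
theorem SimpleGraph.Reachable.mem_of_adj_closed {V : Type*} {G : SimpleGraph V} {u v : V}
    (h : G.Reachable u v) {s : Set V} (hs : ∀ a ∈ s, ∀ b, G.Adj a b → b ∈ s) (hu : u ∈ s) :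
    v ∈ s := by
  by_contra hv
  obtain ⟨p⟩ := h
  obtain ⟨d, -, h1, h2⟩ := p.exists_boundary_dart s hu hv
  exact h2 (hs _ h1 _ d.adj)

section Bandwidth

theorem hasse_nat_adj {a b : ℕ} : (hasse ℕ).Adj a b ↔ a + 1 = b ∨ b + 1 = a := by
  simp [hasse_adj]

theorem hasse_nat_isTree : (hasse ℕ).IsTree := by
  refine ⟨⟨hasse_preconnected_of_succ ℕ⟩, isAcyclic_iff_forall_adj_isBridge.2 ?_⟩
  have key : ∀ a : ℕ, (hasse ℕ).IsBridge s(a, a + 1) := by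
    intro a
    rw [isBridge_iff]
    intro h
    have := h.mem_of_adj_closed (s := Set.Iic a) (fun x hx y hxy => by
      simp only [deleteEdges_adj, hasse_nat_adj, Set.mem_singleton_iff, Sym2.eq_iff,
        Set.mem_Iic] at hxy hx ⊢
      omega) (by simp)
    simp at this
  intro a b hab
  rcases hasse_nat_adj.1 hab with rfl | rfl
  · exact key a
  · rw [Sym2.eq_swap]
    exact key b

theorem hasse_nat_induce_Icc_connected {a b : ℕ} (hab : a ≤ b) :
    ((hasse ℕ).induce (Set.Icc a b)).Connected := by
  have key : ∀ d : ℕ, ∀ h : a + d ∈ Set.Icc a b,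
      ((hasse ℕ).induce (Set.Icc a b)).Reachable ⟨a, by simp [hab]⟩ ⟨a + d, h⟩ := by
    intro d
    induction d with
    | zero => intro h; exact Reachable.refl _
    | succ d ih =>
      intro h
      simp only [Set.mem_Icc] at h
      refine (ih ⟨by omega, by omega⟩).trans (Adj.reachable ?_)
      simp only [comap_adj, Function.Embedding.subtype_apply, hasse_nat_adj]
      omega
  refine connected_iff_exists_forall_reachable _ |>.2 ⟨⟨a, by simp [hab]⟩, ?_⟩
  rintro ⟨x, hx⟩
  obtain ⟨d, rfl⟩ := Nat.exists_eq_add_of_le hx.1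
  exact key d hx

/-- The tree decomposition along a path whose bags are the windows of length `k + 1` of a
linear layout of bandwidth at most `k`. -/
def TreeDecomp.ofLayout {V : Type*} (G : SimpleGraph V) (f : V → ℕ) (k : ℕ)
    (hf : ∀ u v, G.Adj u v → f v ≤ f u + k) : TreeDecomp G where
  ι := ℕ
  tree := hasse ℕ
  isTree := hasse_nat_isTree
  bag t := {v | f v ∈ Set.Icc t (t + k)}
  bag_cover v := ⟨f v, by simp⟩
  bag_edge u v h := by
    have h1 := hf u v h
    have h2 := hf v u h.symm
    exact ⟨min (f u) (f v), by simp only [Set.mem_ofPred_eq, Set.mem_Icc]; omega⟩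
  bag_conn v := by
    have : {t | v ∈ {v | f v ∈ Set.Icc t (t + k)}} = Set.Icc (f v - k) (f v) := by
      ext t
      simp only [Set.mem_ofPred_eq, Set.mem_Icc]
      omega
    rw [this]
    exact hasse_nat_induce_Icc_connected (by omega)

theorem exists_treeDecomp_of_layout {V : Type*} (G : SimpleGraph V) (f : V → ℕ) (k : ℕ)
    (hinj : Function.Injective f) (hf : ∀ u v, G.Adj u v → f v ≤ f u + k) :
    ∃ D : TreeDecomp G, ∀ t, (D.bag t).ncard ≤ k + 1 := by
  refine ⟨TreeDecomp.ofLayout G f k hf, fun (t : ℕ) => ?_⟩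
  calc ({v | f v ∈ Set.Icc t (t + k)} : Set V).ncard
      ≤ (Set.Icc t (t + k)).ncard :=
        Set.ncard_le_ncard_of_injOn f (fun _ h => h) hinj.injOn (Set.finite_Icc _ _)
    _ = k + 1 := by
        rw [Set.ncard_eq_toFinset_card', Set.toFinset_Icc, Nat.card_Icc]
        omega

end Bandwidth

theorem cycleGraph_adj_iff_val {m : ℕ} (hm : 2 ≤ m) {a b : Fin m} :
    (cycleGraph m).Adj a b ↔
      a.val + 1 = b.val ∨ b.val + 1 = a.val ∨ (a.val = 0 ∧ b.val + 1 = m) ∨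
        (b.val = 0 ∧ a.val + 1 = m) := by
  rw [cycleGraph_adj']
  have := a.isLt
  have := b.isLt
  rcases lt_trichotomy a b with h | rfl | h
  · rw [Fin.coe_sub_iff_lt.2 h, Fin.coe_sub_iff_le.2 h.le]
    omega
  · rw [Fin.coe_sub_iff_le.2 le_rfl]
    omega
  · rw [Fin.coe_sub_iff_lt.2 h, Fin.coe_sub_iff_le.2 h.le]
    omega

theorem stackedPrism_adj {m n : ℕ} {x y : Fin m × Fin n} :
    (stackedPrism m n).Adj x y ↔
      (cycleGraph m).Adj x.1 y.1 ∧ x.2 = y.2 ∨ (pathGraph n).Adj x.2 y.2 ∧ x.1 = y.1 :=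
  boxProd_adj

/-- Reading the prism row by row is a layout of bandwidth `m`. -/
theorem stackedPrism_exists_treeDecomp_rows (m n : ℕ) :
    ∃ D : TreeDecomp (stackedPrism m n), ∀ t, (D.bag t).ncard ≤ m + 1 := by
  refine exists_treeDecomp_of_layout _ (fun x => x.1.val + m * x.2.val) m ?_ ?_
  · rintro ⟨i, j⟩ ⟨i', j'⟩ h
    have hm : 0 < m := i.pos
    have h1 := congrArg (· % m) h
    have h2 := congrArg (· / m) h
    simp only [Nat.add_mul_mod_self_left, Nat.mod_eq_of_lt i.isLt, Nat.mod_eq_of_lt i'.isLt] at h1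
    simp only [Nat.add_mul_div_left _ _ hm, Nat.div_eq_of_lt i.isLt, Nat.div_eq_of_lt i'.isLt,
      zero_add] at h2
    exact Prod.ext (Fin.ext h1) (Fin.ext h2)
  · rintro ⟨i, j⟩ ⟨i', j'⟩ h
    rw [stackedPrism_adj] at h
    have := i'.isLt
    rcases h with ⟨-, rfl : j = j'⟩ | ⟨h, rfl : i = i'⟩
    · dsimp only
      omega
    · dsimp only at h ⊢
      rw [pathGraph_adj] at h
      have : m * j'.val ≤ m * (j.val + 1) := Nat.mul_le_mul_left _ (by omega)
      rw [mul_add_one] at this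
      omega

/-- The position of a vertex of `cycleGraph m` in the folded order `0, m - 1, 1, m - 2, …`. -/
def foldedPosition (m i : ℕ) : ℕ :=
  if 2 * i < m then 2 * i else 2 * (m - i) - 1

/-- Reading the prism column by column, with the columns in folded order, is a layout of
bandwidth `2 * n`. -/
theorem stackedPrism_exists_treeDecomp_columns {m : ℕ} (hm : 2 ≤ m) (n : ℕ) :
    ∃ D : TreeDecomp (stackedPrism m n), ∀ t, (D.bag t).ncard ≤ 2 * n + 1 := by
  refine exists_treeDecomp_of_layout _
    (fun x => x.2.val + n * foldedPosition m x.1.val) (2 * n) ?_ ?_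
  · rintro ⟨i, j⟩ ⟨i', j'⟩ h
    have hn : 0 < n := j.pos
    have h1 := congrArg (· % n) h
    have h2 := congrArg (· / n) h
    simp only [Nat.add_mul_mod_self_left, Nat.mod_eq_of_lt j.isLt, Nat.mod_eq_of_lt j'.isLt] at h1
    simp only [Nat.add_mul_div_left _ _ hn, Nat.div_eq_of_lt j.isLt, Nat.div_eq_of_lt j'.isLt,
      zero_add] at h2
    refine Prod.ext (Fin.ext ?_) (Fin.ext h1)
    have := i.isLt
    have := i'.isLt
    simp only [foldedPosition] at h2
    dsimp only
    split_ifs at h2 <;> omega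
  · rintro ⟨i, j⟩ ⟨i', j'⟩ h
    rw [stackedPrism_adj] at h
    have := j'.isLt
    rcases h with ⟨h, rfl : j = j'⟩ | ⟨h, rfl : i = i'⟩
    · dsimp only at h ⊢
      have hb : foldedPosition m i'.val ≤ foldedPosition m i.val + 2 := by
        have := (cycleGraph_adj_iff_val hm).1 h
        have := i.isLt
        have := i'.isLt
        unfold foldedPosition
        split_ifs <;> omega
      have := Nat.mul_le_mul_left n hb
      rw [mul_add] at this
      omega
    · dsimp only
      omega

section EdgeSides

variable {ι : Type*} {T : SimpleGraph ι}

/-- The nodes joined to `t'` after deleting the edge `tt'`. -/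
def edgeSide (T : SimpleGraph ι) (t t' : ι) : Set ι :=
  {x | (T.deleteEdges {s(t, t')}).Reachable t' x}

theorem self_mem_edgeSide (t t' : ι) : t' ∈ edgeSide T t t' := Reachable.refl _

theorem mem_edgeSide_of_adj {t t' x y : ι} (hx : x ∈ edgeSide T t t') (h : T.Adj x y)
    (hne : s(x, y) ≠ s(t, t')) : y ∈ edgeSide T t t' :=
  Reachable.trans hx (Adj.reachable (by simpa [deleteEdges_adj] using ⟨h, by simpa using hne⟩))

theorem mem_edgeSide_or (hT : T.Connected) (t t' x : ι) :
    x ∈ edgeSide T t t' ∨ x ∈ edgeSide T t' t := by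
  refine (hT t' x).mem_of_adj_closed (s := edgeSide T t t' ∪ edgeSide T t' t) ?_
    (Or.inl (self_mem_edgeSide _ _))
  intro a ha b hab
  by_cases he : s(a, b) = s(t, t')
  · rcases Sym2.eq_iff.1 he with ⟨-, rfl⟩ | ⟨-, rfl⟩
    · exact Or.inl (self_mem_edgeSide _ _)
    · exact Or.inr (self_mem_edgeSide _ _)
  · refine ha.imp (fun ha => mem_edgeSide_of_adj ha hab he)
      (fun ha => mem_edgeSide_of_adj ha hab ?_)
    rwa [Sym2.eq_swap (a := t')]

theorem disjoint_edgeSide (hT : T.IsAcyclic) {t t' : ι} (h : T.Adj t t') :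
    Disjoint (edgeSide T t t') (edgeSide T t' t) := by
  refine Set.disjoint_left.2 fun x hx hx' => ?_
  have := isBridge_iff.1 (isAcyclic_iff_forall_adj_isBridge.1 hT h)
  rw [edgeSide, Set.mem_ofPred_eq, Sym2.eq_swap] at hx'
  exact this (Reachable.trans hx' (Reachable.symm hx))

/-- A connected set of nodes meeting both sides of an edge contains the ends of that edge. -/
theorem ends_mem_of_meets_edgeSide (hT : T.IsAcyclic) {t t' : ι} (h : T.Adj t t') {C : Set ι}
    (hC : (T.induce C).Connected) {x y : ι} (hx : x ∈ C) (hy : y ∈ C)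
    (hxs : x ∈ edgeSide T t t') (hys : y ∈ edgeSide T t' t) : t ∈ C ∧ t' ∈ C := by
  by_contra hcon
  refine (disjoint_edgeSide hT h).notMem_of_mem_left ?_ hys
  refine (hC ⟨x, hx⟩ ⟨y, hy⟩).mem_of_adj_closed (s := {z | z.1 ∈ edgeSide T t t'}) ?_ hxs
  rintro ⟨a, ha⟩ has ⟨b, hb⟩ hab
  refine mem_edgeSide_of_adj has hab fun he => hcon ?_
  rcases Sym2.eq_iff.1 he with ⟨rfl, rfl⟩ | ⟨rfl, rfl⟩
  exacts [⟨ha, hb⟩, ⟨hb, ha⟩]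

/-- A side of one edge that misses an end `t'` of another and meets the side at `t'` is contained
in that side. -/
theorem edgeSide_subset_edgeSide {s s' t t' x : ι} (ht : t' ∉ edgeSide T s s')
    (hx : x ∈ edgeSide T s s') (hx' : x ∈ edgeSide T t t') :
    edgeSide T s s' ⊆ edgeSide T t t' := by
  intro y hy
  have hxy : (T.deleteEdges {s(s, s')}).Reachable x y := (Reachable.symm hx).trans hy
  refine (hxy.mem_of_adj_closed (s := edgeSide T s s' ∩ edgeSide T t t') ?_ ⟨hx, hx'⟩).2
  rintro a ⟨ha, ha'⟩ b hab
  have hb : b ∈ edgeSide T s s' := Reachable.trans ha hab.reachable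
  refine ⟨hb, mem_edgeSide_of_adj ha' (deleteEdges_le _ hab) fun he => ht ?_⟩
  rcases Sym2.eq_iff.1 he with ⟨-, rfl⟩ | ⟨rfl, -⟩
  exacts [hb, ha]

theorem SimpleGraph.Walk.IsPath.mem_edgeSide {t x : ι} {p : T.Walk t x} (hp : p.IsPath) :
    ∀ d ∈ p.darts, x ∈ edgeSide T d.fst d.snd ∧ t ∈ edgeSide T d.snd d.fst := by
  induction p with
  | nil => simp
  | @cons t u x h q ih =>
    rw [Walk.cons_isPath_iff] at hp
    intro d hd
    rw [Walk.darts_cons, List.mem_cons] at hd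
    rcases hd with rfl | hd
    · refine ⟨reachable_deleteEdges_iff_exists_walk.2 ⟨q, fun he => hp.2 ?_⟩,
        self_mem_edgeSide _ _⟩
      exact q.fst_mem_support_of_mem_edges he
    · obtain ⟨h1, h2⟩ := ih hp.1 d hd
      refine ⟨h1, mem_edgeSide_of_adj h2 h.symm fun he => hp.2 ?_⟩
      rcases Sym2.eq_iff.1 he with ⟨-, rfl⟩ | ⟨-, rfl⟩
      exacts [q.dart_fst_mem_support_of_mem_darts hd, q.dart_snd_mem_support_of_mem_darts hd]

end EdgeSides

namespace TreeDecomp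

variable {V : Type*} {G : SimpleGraph V} (D : TreeDecomp G)

/-- The vertices in the bags on the side of `t'` of the edge `tt'`. -/
def verticesBeyond (t t' : D.ι) : Set V :=
  {v | ∃ x ∈ edgeSide D.tree t t', v ∈ D.bag x}

/-- The common vertices of two bags. -/
def adhesion (t t' : D.ι) : Set V := D.bag t ∩ D.bag t'

variable {D}

theorem mem_adhesion_of_mem_bag {t t' x y : D.ι} (h : D.tree.Adj t t') {v : V}
    (hx : x ∈ edgeSide D.tree t t') (hy : y ∈ edgeSide D.tree t' t) (hvx : v ∈ D.bag x)
    (hvy : v ∈ D.bag y) : v ∈ D.adhesion t t' :=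
  ends_mem_of_meets_edgeSide D.isTree.isAcyclic h (D.bag_conn v) hvx hvy hx hy

theorem verticesBeyond_of_adj {t t' : D.ι} (h : D.tree.Adj t t') {u v : V} (huv : G.Adj u v)
    (hu : u ∈ D.verticesBeyond t t') (hu' : u ∉ D.adhesion t t') :
    v ∈ D.verticesBeyond t t' := by
  obtain ⟨x, hx, hux⟩ := hu
  obtain ⟨y, huy, hvy⟩ := D.bag_edge huv
  rcases mem_edgeSide_or D.isTree.connected t t' y with hy | hy
  · exact ⟨y, hy, hvy⟩
  · exact absurd (mem_adhesion_of_mem_bag h hx hy hux huy) hu'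

/-- From a bag missing `v` one can move towards `v` across an edge at which the bag changes. -/
theorem exists_edge_towards (t : D.ι) {v : V} (hv : v ∉ D.bag t) :
    ∃ s s' x, D.tree.Adj s s' ∧ D.bag s = D.bag t ∧ D.bag s' ≠ D.bag t ∧ v ∈ D.bag x ∧
      x ∈ edgeSide D.tree s s' ∧ t ∈ edgeSide D.tree s' s := by
  obtain ⟨x, hx⟩ := D.bag_cover v
  obtain ⟨p, hp⟩ := (D.isTree.connected t x).exists_isPath
  obtain ⟨d, hd, h1, h2⟩ := p.exists_boundary_dart {s | D.bag s = D.bag t} rfl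
    (fun h : D.bag x = D.bag t => hv (h ▸ hx))
  obtain ⟨h3, h4⟩ := hp.mem_edgeSide d hd
  exact ⟨d.fst, d.snd, x, d.adj, h1, h2, hx, h3, h4⟩

/-- If every vertex set `S` of size less than `w` has a connected set `big S` avoiding it, and for
every vertex set `X` of size at most `w` some vertex outside `X` lies in `big S` for all small
`S ⊆ X`, then every tree decomposition has a bag of size more than `w`. -/
theorem exists_lt_ncard_bag [Finite V] (D : TreeDecomp G) {w : ℕ} (big : Set V → Set V)
    (hdisj : ∀ S, Disjoint (big S) S)
    (hconn : ∀ S, S.ncard < w → (G.induce (big S)).Preconnected)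
    (hpick : ∀ X : Set V, X.ncard ≤ w → ∃ v ∉ X, ∀ S ⊆ X, S.ncard < w → v ∈ big S) :
    ∃ t, w < (D.bag t).ncard := by
  by_contra! hw
  have step : ∀ t, ∃ s s' v x, D.tree.Adj s s' ∧ D.bag s = D.bag t ∧ D.bag s' ≠ D.bag t ∧
      (D.adhesion s s').ncard < w ∧ v ∉ D.bag t ∧ v ∈ D.bag x ∧
      (∀ S ⊆ D.bag t, S.ncard < w → v ∈ big S) ∧
      x ∈ edgeSide D.tree s s' ∧ t ∈ edgeSide D.tree s' s ∧
      big (D.adhesion s s') ⊆ D.verticesBeyond s s' := by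
    intro t
    obtain ⟨v, hv, hvS⟩ := hpick _ (hw t)
    obtain ⟨s, s', x, hs, hbag, hne, hvx, hx, ht⟩ := exists_edge_towards t hv
    have hlt : (D.adhesion s s').ncard < w := by
      by_contra! hle
      refine hne ?_
      rw [← hbag, ← Set.eq_of_subset_of_ncard_le Set.inter_subset_left ((hw s).trans hle),
        Set.eq_of_subset_of_ncard_le Set.inter_subset_right ((hw s').trans hle)]
    have hvbig : v ∈ big (D.adhesion s s') := hvS _ (hbag ▸ Set.inter_subset_left) hlt
    refine ⟨s, s', v, x, hs, hbag, hne, hlt, hv, hvx, hvS, hx, ht, fun u hu => ?_⟩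
    refine (hconn _ hlt ⟨v, hvbig⟩ ⟨u, hu⟩).mem_of_adj_closed
      (s := {z | z.1 ∈ D.verticesBeyond s s'}) ?_ ⟨x, hx, hvx⟩
    rintro ⟨a, ha⟩ has ⟨b, hb⟩ hab
    exact verticesBeyond_of_adj hs hab has ((hdisj _).notMem_of_mem_left ha)
  have main : ∀ N t t', D.tree.Adj t t' → (D.adhesion t t').ncard < w →
      big (D.adhesion t t') ⊆ D.verticesBeyond t t' →
      (D.verticesBeyond t t').ncard * (w + 1) + (w - (D.bag t').ncard) = N → False := by
    intro N
    induction N using Nat.strong_induction_on with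
    | _ N ih =>
    rintro t t' h hlt hbig rfl
    obtain ⟨s, s', v, x, hs, hbag, hne, hlt', hv, hvx, hvS, hx, ht', hbig'⟩ := step t'
    have hxt : x ∈ edgeSide D.tree t t' := by
      refine (mem_edgeSide_or D.isTree.connected t t' x).resolve_right fun hx' => hv ?_
      obtain ⟨y, hy, hvy⟩ := hbig (hvS _ Set.inter_subset_right hlt)
      exact (mem_adhesion_of_mem_bag h hy hx' hvy hvx).2
    have hsub : edgeSide D.tree s s' ⊆ edgeSide D.tree t t' :=
      edgeSide_subset_edgeSide ((disjoint_edgeSide D.isTree.isAcyclic hs).notMem_of_mem_right ht')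
        hx hxt
    have hsub' : D.verticesBeyond s s' ⊆ D.verticesBeyond t t' :=
      fun _ ⟨y, hy, hvy⟩ => ⟨y, hsub hy, hvy⟩
    refine ih _ ?_ s s' hs hlt' hbig' rfl
    by_cases hbs : D.bag t' ⊆ D.bag s'
    · have h1 := Set.ncard_le_ncard hsub'
      have h2 := Set.ncard_lt_ncard (hbs.ssubset_of_ne hne.symm)
      have h3 := hw s'
      have h4 := Nat.mul_le_mul_right (w + 1) h1
      omega
    · obtain ⟨u, hu, hus⟩ := Set.not_subset.1 hbs
      have h1 : (D.verticesBeyond s s').ncard < (D.verticesBeyond t t').ncard := by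
        refine Set.ncard_lt_ncard (hsub'.ssubset_of_ne fun heq => hus ?_)
        obtain ⟨y, hy, huy⟩ : u ∈ D.verticesBeyond s s' := heq ▸ ⟨t', self_mem_edgeSide _ _, hu⟩
        exact (mem_adhesion_of_mem_bag hs hy (self_mem_edgeSide _ _) huy (hbag ▸ hu)).2
      have h4 := Nat.mul_le_mul_right (w + 1) (Nat.succ_le_of_lt h1)
      rw [Nat.succ_mul] at h4
      omega
  obtain ⟨t⟩ := D.isTree.connected.nonempty
  obtain ⟨s, s', v, x, hs, -, -, hlt, -, -, -, -, -, hbig⟩ := step t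
  exact main _ s s' hs hlt hbig rfl

end TreeDecomp

/-- Deleting a vertex from a cycle leaves a connected graph. -/
theorem cycleGraph_preconnected_compl_singleton {m : ℕ} (hm : 2 ≤ m) (p : Fin m) :
    ((cycleGraph m).induce {p}ᶜ).Preconnected := by
  let c (k : ℕ) : Fin m := ⟨(p.val + k) % m, Nat.mod_lt _ (by omega)⟩
  have hc : ∀ k, 0 < k → k < m → c k ≠ p := by
    intro k h0 hk h
    have h : (p.val + k) % m = p.val := congrArg Fin.val h
    have := p.isLt
    have := Nat.div_add_mod (p.val + k) m
    rw [h] at this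
    rcases Nat.eq_zero_or_pos ((p.val + k) / m) with h' | h'
    · rw [h'] at this
      omega
    · have := Nat.le_mul_of_pos_right m h'
      omega
  have key : ∀ k (hk : k + 1 < m), ((cycleGraph m).induce {p}ᶜ).Reachable
      ⟨c 1, hc 1 one_pos (by omega)⟩ ⟨c (k + 1), hc _ k.succ_pos hk⟩ := by
    intro k
    induction k with
    | zero => intro _; exact Reachable.refl _
    | succ k ih =>
      intro hk
      refine (ih (by omega)).trans (Adj.reachable ?_)
      simp only [comap_adj, Function.Embedding.subtype_apply, cycleGraph_adj_iff_val hm, c]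
      rw [← add_assoc p.val (k + 1) 1, Nat.add_mod_eq_ite (m := p.val + (k + 1))]
      have := Nat.mod_lt (p.val + (k + 1)) (show 0 < m by omega)
      rw [Nat.mod_eq_of_lt (show 1 < m by omega)]
      split_ifs <;> omega
  refine (connected_iff_exists_forall_reachable _ |>.2
    ⟨⟨c 1, hc 1 one_pos (by omega)⟩, ?_⟩).preconnected
  rintro ⟨a, ha⟩
  have ha : a.val ≠ p.val := fun h => ha (Fin.ext h)
  have := a.isLt
  have := p.isLt
  obtain ⟨k, hk, hka⟩ : ∃ k, k + 1 < m ∧ c (k + 1) = a := by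
    rcases lt_or_gt_of_ne ha with h | h
    · refine ⟨m + a.val - p.val - 1, by omega, Fin.ext ?_⟩
      change (p.val + (m + a.val - p.val - 1 + 1)) % m = a.val
      rw [show p.val + (m + a.val - p.val - 1 + 1) = a.val + m by omega, Nat.add_mod_right,
        Nat.mod_eq_of_lt a.isLt]
    · refine ⟨a.val - p.val - 1, by omega, Fin.ext ?_⟩
      change (p.val + (a.val - p.val - 1 + 1)) % m = a.val
      rw [show p.val + (a.val - p.val - 1 + 1) = a.val by omega, Nat.mod_eq_of_lt a.isLt]
  subst hka
  exact key k hk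

section Prism

variable {m n : ℕ} {S : Set (Fin m × Fin n)}

/-- Column `i` of the prism avoids `S`. -/
def ColumnFree (S : Set (Fin m × Fin n)) (i : Fin m) : Prop := ∀ j, (i, j) ∉ S

/-- Row `j` of the prism meets `S` in at most one vertex. -/
def RowSparse (S : Set (Fin m × Fin n)) (j : Fin n) : Prop := ∃ p, ∀ i, (i, j) ∈ S → i = p

/-- The vertices outside `S` whose column avoids `S` or whose row meets `S` at most once. -/
def prismCore (S : Set (Fin m × Fin n)) : Set (Fin m × Fin n) :=
  {x | x ∉ S ∧ (ColumnFree S x.1 ∨ RowSparse S x.2)}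

theorem exists_columnFree (h : S.ncard < m) : ∃ i, ColumnFree S i := by
  by_contra! hcon
  simp only [ColumnFree, not_forall, not_not] at hcon
  choose g hg using hcon
  have := Set.ncard_le_ncard_of_injOn (s := Set.univ) (t := S) (fun i => (i, g i))
    (fun i _ => hg i) (fun a _ b _ h => congrArg Prod.fst h)
  rw [Set.ncard_univ, Nat.card_fin] at this
  omega

theorem exists_rowSparse (hm : 0 < m) (h : S.ncard < 2 * n) : ∃ j, RowSparse S j := by
  by_contra! hcon
  simp only [RowSparse, not_exists, not_forall] at hcon
  choose g hg hgne using hcon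
  let f (x : Fin n × Bool) : Fin m × Fin n :=
    (if x.2 then g x.1 ⟨0, hm⟩ else g x.1 (g x.1 ⟨0, hm⟩), x.1)
  have := Set.ncard_le_ncard_of_injOn (s := Set.univ) (t := S) f
    (by rintro ⟨j, _ | _⟩ - <;> simp [f, hg]) (by
      rintro ⟨j, b⟩ - ⟨j', b'⟩ - h
      obtain rfl : j = j' := congrArg Prod.snd h
      have h1 := congrArg Prod.fst h
      have h2 := hgne j (g j ⟨0, hm⟩)
      cases b <;> cases b'
      exacts [rfl, absurd h1 h2, absurd h1.symm h2, rfl])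
  rw [Set.ncard_univ, Nat.card_prod, Nat.card_fin, Nat.card_eq_fintype_card,
    Fintype.card_bool] at this
  omega

theorem prismCore_reachable_of_columnFree {i : Fin m} (hi : ColumnFree S i) (j j' : Fin n) :
    ((stackedPrism m n).induce (prismCore S)).Reachable
      ⟨(i, j), hi j, Or.inl hi⟩ ⟨(i, j'), hi j', Or.inl hi⟩ :=
  (pathGraph_preconnected n j j').map
    (⟨fun k => ⟨(i, k), hi k, Or.inl hi⟩, fun h => stackedPrism_adj.2 (Or.inr ⟨h, rfl⟩)⟩ :
      pathGraph n →g (stackedPrism m n).induce (prismCore S))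

theorem prismCore_reachable_of_rowSparse (hm : 3 ≤ m) {j : Fin n} (hj : RowSparse S j)
    {i i' : Fin m} (hi : (i, j) ∉ S) (hi' : (i', j) ∉ S) :
    ((stackedPrism m n).induce (prismCore S)).Reachable
      ⟨(i, j), hi, Or.inr hj⟩ ⟨(i', j), hi', Or.inr hj⟩ := by
  obtain ⟨p, hp, hpi, hpi'⟩ : ∃ p, (∀ k, k ≠ p → (k, j) ∉ S) ∧ i ≠ p ∧ i' ≠ p := by
    obtain ⟨p, hp⟩ := hj
    by_cases hpS : (p, j) ∈ S
    · exact ⟨p, fun k hk h => hk (hp k h), fun h => hi (h ▸ hpS), fun h => hi' (h ▸ hpS)⟩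
    · obtain ⟨q, hq⟩ : ∃ q, q ∉ ({i, i'} : Finset (Fin m)) := by
        by_contra! hall
        have h1 := Finset.card_le_card fun q (_ : q ∈ Finset.univ) => hall q
        have h2 := Finset.card_le_two (a := i) (b := i')
        rw [Finset.card_univ, Fintype.card_fin] at h1
        omega
      simp only [Finset.mem_insert, Finset.mem_singleton, not_or] at hq
      exact ⟨q, fun k _ h => hpS (hp k h ▸ h), Ne.symm hq.1, Ne.symm hq.2⟩
  exact (cycleGraph_preconnected_compl_singleton (by omega) p ⟨i, hpi⟩ ⟨i', hpi'⟩).map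
    (⟨fun k => ⟨(k.1, j), hp k.1 k.2, Or.inr hj⟩,
        fun h => stackedPrism_adj.2 (Or.inl ⟨h, rfl⟩)⟩ :
      (cycleGraph m).induce {p}ᶜ →g (stackedPrism m n).induce (prismCore S))

theorem prismCore_preconnected (hm : 3 ≤ m) (hS : S.ncard < min m (2 * n)) :
    ((stackedPrism m n).induce (prismCore S)).Preconnected := by
  obtain ⟨i, hi⟩ := exists_columnFree (lt_min_iff.1 hS).1
  obtain ⟨j, hj⟩ := exists_rowSparse (by omega) (lt_min_iff.1 hS).2
  have key : ∀ x : prismCore S, ((stackedPrism m n).induce (prismCore S)).Reachable x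
      ⟨(i, j), hi j, Or.inl hi⟩ := by
    rintro ⟨⟨k, l⟩, hx, hk | hl⟩
    · exact (prismCore_reachable_of_columnFree hk l j).trans
        (prismCore_reachable_of_rowSparse hm hj (hk j) (hi j))
    · exact (prismCore_reachable_of_rowSparse hm hl hx (hi l)).trans
        (prismCore_reachable_of_columnFree hi l j)
  exact fun x y => (key x).trans (key y).symm

theorem exists_mem_prismCore_of_subset (hm : 3 ≤ m) (hn : 1 ≤ n) (hmn : m ≠ 2 * n)
    {X : Set (Fin m × Fin n)} (hX : X.ncard ≤ min m (2 * n)) :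
    ∃ v ∉ X, ∀ S ⊆ X, v ∈ prismCore S := by
  have : X.ncard < m ∨ X.ncard < 2 * n := by omega
  rcases this with h | h
  · obtain ⟨i, hi⟩ := exists_columnFree h
    exact ⟨(i, ⟨0, hn⟩), hi _, fun S hS =>
      ⟨fun h => hi _ (hS h), Or.inl fun j h => hi j (hS h)⟩⟩
  · obtain ⟨j, p, hp⟩ := exists_rowSparse (by omega) h
    have : Nontrivial (Fin m) := Fin.nontrivial_iff_two_le.2 (by omega)
    obtain ⟨i, hi⟩ := exists_ne p
    exact ⟨(i, j), fun h => hi (hp i h), fun S hS =>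
      ⟨fun h => hi (hp i (hS h)), Or.inr ⟨p, fun k h => hp k (hS h)⟩⟩⟩

end Prism

/-- If `m ≥ 3`, `n ≥ 1` and `m ≠ 2n`, the treewidth of the stacked prism `Y_{m,n}`
equals `min {m, 2n}`. -/
theorem stackedPrism_treewidth (m n : ℕ) (hm : 3 ≤ m) (hn : 1 ≤ n) (hmn : m ≠ 2 * n) :
    treewidth (stackedPrism m n) = min m (2 * n) := by
  have hmem : min m (2 * n) ∈ {k : ℕ | ∃ D : TreeDecomp (stackedPrism m n),
      ∀ t, (D.bag t).ncard ≤ k + 1} := by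
    rcases min_choice m (2 * n) with h | h <;> rw [h]
    · exact stackedPrism_exists_treeDecomp_rows m n
    · exact stackedPrism_exists_treeDecomp_columns (by omega) n
  refine le_antisymm (Nat.sInf_le hmem) (le_csInf ⟨_, hmem⟩ ?_)
  rintro k ⟨D, hD⟩
  obtain ⟨t, ht⟩ := D.exists_lt_ncard_bag prismCore
    (fun S => Set.disjoint_left.2 fun _ h => h.1)
    (fun S hS => prismCore_preconnected hm hS)
    (fun X hX => (exists_mem_prismCore_of_subset hm hn hmn hX).imp
      fun v hv => ⟨hv.1, fun S hS _ => hv.2 S hS⟩)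
  have := hD t
  omega
end

section
/- For every integer n ≥ 2, the treewidth of the stacked prism graph Y_{2n,n} satisfies 2n − 1 ≤ tw(Y_{2n,n}) ≤ 2n. -/
open SimpleGraph

namespace SimpleGraph

section Helly

variable {ι : Type*} {T : SimpleGraph ι}

/-- A rooted tree has a parent function: along every edge the depth changes by one and the
deeper endpoint has the other one as its parent. -/
theorem IsTree.exists_depth_parent (hT : T.IsTree) :
    ∃ (d : ι → ℕ) (p : ι → ι), ∀ a b, T.Adj a b →
      (d a = d b + 1 ∧ p a = b) ∨ (d b = d a + 1 ∧ p b = a) := by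
  classical
  obtain ⟨r⟩ := hT.connected.nonempty
  have unique : ∀ a b c, T.Adj b a → T.Adj c a → T.dist r a = T.dist r b + 1 →
      T.dist r a = T.dist r c + 1 → b = c := by
    intro a b c hba hca hb hc
    obtain ⟨P, -, hP⟩ := (hT.connected r b).exists_path_of_dist
    obtain ⟨Q, -, hQ⟩ := (hT.connected r c).exists_path_of_dist
    have hP' : (P.concat hba).IsPath :=
      Walk.isPath_of_length_eq_dist _ (by rw [Walk.length_concat]; omega)
    have hQ' : (Q.concat hca).IsPath :=
      Walk.isPath_of_length_eq_dist _ (by rw [Walk.length_concat]; omega)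
    have h := (hT.existsUnique_path r a).unique hP' hQ'
    simpa using congrArg Walk.penultimate h
  have key : ∀ a, ∃ q, ∀ b, T.Adj a b → T.dist r a = T.dist r b + 1 → q = b := by
    intro a
    by_cases h : ∃ b, T.Adj a b ∧ T.dist r a = T.dist r b + 1
    · obtain ⟨b, hab, hb⟩ := h
      exact ⟨b, fun c hac hc => unique a b c hab.symm hac.symm hb hc⟩
    · exact ⟨a, fun b hab hb => (h ⟨b, hab, hb⟩).elim⟩
  choose p hp using key
  refine ⟨T.dist r, p, fun a b hab => ?_⟩
  rcases hT.dist_eq_dist_add_one_of_adj r hab with h | h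
  · exact Or.inl ⟨h, hp a b hab h⟩
  · exact Or.inr ⟨h, hp b a hab.symm h⟩

variable {d : ι → ℕ} {p : ι → ι} {C : Set ι}

theorem Preconnected.exists_iterate_parent_eq
    (hp : ∀ a b, T.Adj a b → (d a = d b + 1 ∧ p a = b) ∨ (d b = d a + 1 ∧ p b = a))
    (hC : (T.induce C).Preconnected) {u : ι} (hu : u ∈ C)
    (hmin : ∀ w ∈ C, T.Adj u w → d u < d w) {w : ι} (hw : w ∈ C) :
    ∃ k, d w = d u + k ∧ p^[k] w = u := by
  have h := (reachable_iff_reflTransGen _ _).1 (hC ⟨u, hu⟩ ⟨w, hw⟩)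
  suffices ∀ v : C, Relation.ReflTransGen (T.induce C).Adj ⟨u, hu⟩ v →
      ∃ k, d v = d u + k ∧ p^[k] v = u from this _ h
  intro v hv
  induction hv with
  | refl => exact ⟨0, rfl, rfl⟩
  | @tail b c _ hbc ih =>
    obtain ⟨k, hk, hku⟩ := ih
    have hadj : T.Adj b c := hbc
    rcases hp _ _ hadj with ⟨hd, hpb⟩ | ⟨hd, hpc⟩
    · cases k with
      | zero =>
        simp only [Function.iterate_zero, id_eq] at hku
        have := hmin c c.2 (hku ▸ hadj)
        omega
      | succ k =>
        rw [Function.iterate_succ_apply, hpb] at hku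
        exact ⟨k, by omega, hku⟩
    · exact ⟨k + 1, by omega, by rw [Function.iterate_succ_apply, hpc, hku]⟩

theorem Preconnected.parent_mem
    (hp : ∀ a b, T.Adj a b → (d a = d b + 1 ∧ p a = b) ∨ (d b = d a + 1 ∧ p b = a))
    (hC : (T.induce C).Preconnected) {a u : ι} (ha : a ∈ C) (hu : u ∈ C) (hlt : d a < d u) :
    p u ∈ C ∧ d (p u) + 1 = d u := by
  by_contra hcon
  obtain ⟨k, hk, -⟩ := hC.exists_iterate_parent_eq hp hu (fun w hw huw => by
    rcases hp _ _ huw with ⟨h, rfl⟩ | ⟨h, -⟩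
    · exact (hcon ⟨hw, h.symm⟩).elim
    · omega) ha
  omega

theorem Preconnected.iterate_parent_mem
    (hp : ∀ a b, T.Adj a b → (d a = d b + 1 ∧ p a = b) ∨ (d b = d a + 1 ∧ p b = a))
    (hC : (T.induce C).Preconnected) {a u : ι} (ha : a ∈ C) (hu : u ∈ C) {k : ℕ}
    (hk : d a + k ≤ d u) : p^[k] u ∈ C ∧ d (p^[k] u) + k = d u := by
  induction k with
  | zero => exact ⟨hu, rfl⟩
  | succ k ih =>
    obtain ⟨hmem, hd⟩ := ih (by omega)
    obtain ⟨hmem', hd'⟩ := hC.parent_mem hp ha hmem (by omega)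
    rw [Function.iterate_succ_apply']
    exact ⟨hmem', by omega⟩

/-- The Helly property of subtrees. -/
theorem IsTree.exists_mem_of_pairwise_inter_nonempty {κ : Type*} [Finite κ] [Nonempty κ]
    (hT : T.IsTree) (C : κ → Set ι) (hC : ∀ i, (T.induce (C i)).Preconnected)
    (hinter : ∀ i j, (C i ∩ C j).Nonempty) : ∃ t, ∀ i, t ∈ C i := by
  obtain ⟨d, p, hp⟩ := hT.exists_depth_parent
  have hmin : ∀ i, ∃ a ∈ C i, ∀ b ∈ C i, d a ≤ d b := fun i => by
    obtain ⟨a, ha, h⟩ := (measure d).wf.has_min (C i) ((hinter i i).mono Set.inter_subset_left)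
    exact ⟨a, ha, fun b hb => not_lt.1 (h b hb)⟩
  choose a ha hle using hmin
  obtain ⟨i, hi⟩ := Finite.exists_max fun i => d (a i)
  refine ⟨a i, fun j => ?_⟩
  obtain ⟨u, hui, huj⟩ := hinter i j
  obtain ⟨k, hk, hku⟩ := (hC i).exists_iterate_parent_eq hp (ha i) (fun w hw haw => by
    have := hle i w hw
    rcases hp _ _ haw with h | h <;> omega) hui
  have hij := hi j
  rw [← hku]
  exact ((hC j).iterate_parent_mem hp (ha j) huj (by omega)).1

end Helly

theorem Connected.induce_range {V W : Type*} {G : SimpleGraph V} {H : SimpleGraph W}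
    (hG : G.Connected) (f : G →g H) : (H.induce (Set.range f)).Connected :=
  hG.map (⟨Set.rangeFactorization f, fun h => f.map_adj h⟩ : G →g H.induce (Set.range f))
    Set.rangeFactorization_surjective

theorem Connected.induce_image {V W : Type*} {G : SimpleGraph V} {H : SimpleGraph W} {s : Set V}
    (hs : (G.induce s).Connected) (f : G →g H) : (H.induce (f '' s)).Connected := by
  have h := hs.induce_range (f.comp (Embedding.induce s).toHom)
  rwa [show Set.range (f.comp (Embedding.induce s).toHom) = f '' s by
    ext; simp] at h

theorem pathGraph_isTree (n : ℕ) : (pathGraph (n + 1)).IsTree := by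
  refine ⟨pathGraph_connected n, isAcyclic_iff_forall_adj_isBridge.2 ?_⟩
  have key : ∀ u v : Fin (n + 1), u.val + 1 = v.val → (pathGraph (n + 1)).IsBridge s(u, v) := by
    intro u v huv
    rw [isBridge_iff]
    intro h
    suffices ∀ w, Relation.ReflTransGen
        ((pathGraph (n + 1)).deleteEdges {s(u, v)}).Adj u w → w ≤ u by
      have := this v ((reachable_iff_reflTransGen _ _).1 h)
      omega
    intro w hw
    induction hw with
    | refl => exact le_rfl
    | @tail b c _ hbc ih =>
      rw [deleteEdges_adj, pathGraph_adj] at hbc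
      obtain ⟨h1, h2⟩ := hbc
      by_contra hcu
      have hb : b = u := by ext; omega
      have hc : c = v := by ext; omega
      exact h2 (by rw [hb, hc]; rfl)
  intro u v huv
  rcases pathGraph_adj.1 huv with h | h
  · exact key u v h
  · rw [Sym2.eq_swap]
    exact key v u h

theorem cycleGraph_induce_compl_singleton_connected (m : ℕ) (x : Fin (m + 2)) :
    ((cycleGraph (m + 2)).induce {x}ᶜ).Connected := by
  let f : pathGraph (m + 1) →g cycleGraph (m + 2) :=
    ⟨fun k => x + k.succ, by
      have key : ∀ a b : Fin (m + 1), a.val + 1 = b.val → b.succ - a.succ = 1 := by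
        intro a b h
        rw [sub_eq_iff_eq_add', Fin.ext_iff]
        have hlt : a.succ < Fin.last (m + 1) := by
          rw [Fin.lt_def, Fin.val_succ, Fin.val_last]
          omega
        exact (congrArg (· + 1) h.symm).trans (Fin.val_add_one_of_lt hlt).symm
      intro a b hab
      rw [cycleGraph_adj, add_sub_add_left_eq_sub, add_sub_add_left_eq_sub]
      exact (pathGraph_adj.1 hab).symm.imp (key b a) (key a b)⟩
  have hf : Set.range f = {x}ᶜ := by
    ext y
    simp only [Set.mem_range, Set.mem_compl_iff, Set.mem_singleton_iff]
    constructor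
    · rintro ⟨k, rfl⟩ h
      exact Fin.succ_ne_zero k (add_eq_left.1 h)
    · intro h
      obtain ⟨k, hk⟩ := Fin.exists_succ_eq.2 (sub_ne_zero.2 h)
      exact ⟨k, by change x + k.succ = y; rw [hk, add_sub_cancel]⟩
  exact hf ▸ (pathGraph_connected m).induce_range f

end SimpleGraph

namespace TreeDecomp

variable {V : Type*} {G : SimpleGraph V}

/-- The nodes whose bags meet a connected vertex set form a subtree. -/
theorem preconnected_induce_bag_inter (D : TreeDecomp G) {B : Set V}
    (hB : (G.induce B).Preconnected) :
    (D.tree.induce {t | (D.bag t ∩ B).Nonempty}).Preconnected := by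
  have within : ∀ v ∈ B, ∀ (s t : {t | (D.bag t ∩ B).Nonempty}), v ∈ D.bag s → v ∈ D.bag t →
      (D.tree.induce {t | (D.bag t ∩ B).Nonempty}).Reachable s t := by
    intro v hv s t hs ht
    have h : {t | v ∈ D.bag t} ⊆ {t | (D.bag t ∩ B).Nonempty} := fun _ ht => ⟨v, ht, hv⟩
    exact (D.bag_conn v ⟨s, hs⟩ ⟨t, ht⟩).map (induceHomOfLE D.tree h).toHom
  rintro s ⟨t, y, hyt, hyB⟩
  obtain ⟨x, hxs, hxB⟩ := s.2
  suffices ∀ w : B, Relation.ReflTransGen (G.induce B).Adj ⟨x, hxB⟩ w →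
      ∀ t : {t | (D.bag t ∩ B).Nonempty}, w.1 ∈ D.bag t →
        (D.tree.induce {t | (D.bag t ∩ B).Nonempty}).Reachable s t from
    this ⟨y, hyB⟩ ((reachable_iff_reflTransGen _ _).1 (hB _ _)) _ hyt
  intro w hw
  induction hw with
  | refl => exact fun t ht => within x hxB s t hxs ht
  | @tail b c _ hbc ih =>
    intro t ht
    obtain ⟨q, hbq, hcq⟩ := D.bag_edge (show G.Adj b c from hbc)
    exact (ih ⟨q, b, hbq, b.2⟩ hbq).trans (within c c.2 _ t hcq ht)

/-- Some bag of a tree decomposition hits every member of a finite family of connected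
vertex sets that pairwise intersect or are joined by an edge. -/
theorem exists_isHittingSet_bag (D : TreeDecomp G) {ℬ : Set (Set V)} (hfin : ℬ.Finite)
    (hconn : ∀ B ∈ ℬ, (G.induce B).Connected)
    (htouch : ∀ A ∈ ℬ, ∀ B ∈ ℬ, ∃ a ∈ A, ∃ b ∈ B, a = b ∨ G.Adj a b) :
    ∃ t, IsHittingSet ℬ (D.bag t) := by
  rcases ℬ.eq_empty_or_nonempty with rfl | hne
  · obtain ⟨t⟩ := D.isTree.connected.nonempty
    exact ⟨t, fun B hB => hB.elim⟩
  have := hfin.to_subtype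
  have := hne.to_subtype
  obtain ⟨t, ht⟩ := D.isTree.exists_mem_of_pairwise_inter_nonempty
    (fun B : ℬ => {t | (D.bag t ∩ B).Nonempty})
    (fun B => D.preconnected_induce_bag_inter (hconn B B.2).preconnected) (fun A B => by
      obtain ⟨a, ha, b, hb, rfl | hab⟩ := htouch A A.2 B B.2
      · obtain ⟨t, ht⟩ := D.bag_cover a
        exact ⟨t, ⟨a, ht, ha⟩, ⟨a, ht, hb⟩⟩
      · obtain ⟨t, hat, hbt⟩ := D.bag_edge hab
        exact ⟨t, ⟨a, hat, ha⟩, ⟨b, hbt, hb⟩⟩)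
  exact ⟨t, fun B hB => ht ⟨B, hB⟩⟩

/-- The path decomposition into windows of `w + 1` consecutive vertices given by a vertex
ordering of bandwidth at most `w`. -/
theorem exists_of_bandwidth_le {N : ℕ} (w : ℕ) (e : V ↪ Fin (N + 1))
    (he : ∀ u v, G.Adj u v → (e v : ℕ) ≤ e u + w) :
    ∃ D : TreeDecomp G, ∀ t, (D.bag t).ncard ≤ w + 1 := by
  refine ⟨{ ι := Fin (N + 1)
            tree := pathGraph (N + 1)
            isTree := pathGraph_isTree N
            bag := fun t => {v | (t : ℕ) ≤ e v ∧ (e v : ℕ) ≤ t + w}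
            bag_cover := fun v => ⟨e v, le_rfl, Nat.le_add_right _ _⟩
            bag_edge := ?_
            bag_conn := ?_ }, ?_⟩
  · intro u v huv
    have h1 := he u v huv
    have h2 := he v u huv.symm
    rcases le_total (e u : ℕ) (e v) with h | h
    · exact ⟨e u, ⟨le_rfl, Nat.le_add_right _ _⟩, h, h1⟩
    · exact ⟨e v, ⟨h, h2⟩, le_rfl, Nat.le_add_right _ _⟩
  · intro v
    let f : pathGraph (min w (e v) + 1) →g pathGraph (N + 1) :=
      ⟨fun k => ⟨e v - k, by omega⟩, by
        intro a b hab
        rw [pathGraph_adj] at hab ⊢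
        dsimp only
        omega⟩
    have hf : Set.range f = {t : Fin (N + 1) | v ∈ {v | (t : ℕ) ≤ e v ∧ (e v : ℕ) ≤ t + w}} := by
      ext t
      simp only [Set.mem_range, Set.mem_ofPred_eq, Fin.ext_iff]
      constructor
      · rintro ⟨k, hk⟩
        change (e v : ℕ) - k = t at hk
        omega
      · rintro ⟨h1, h2⟩
        refine ⟨⟨e v - t, by omega⟩, ?_⟩
        change (e v : ℕ) - (e v - t) = t
        omega
    exact hf ▸ (pathGraph_connected _).induce_range f
  · intro t
    have h := Set.ncard_le_ncard_of_injOn (s := {v | (t : ℕ) ≤ e v ∧ (e v : ℕ) ≤ t + w})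
      (t := Set.Icc (t : ℕ) (t + w)) (fun v => (e v : ℕ)) (fun v hv => hv)
      (fun _ _ _ _ h => e.injective (Fin.ext h)) (Set.finite_Icc _ _)
    refine h.trans ?_
    rw [← Finset.coe_Icc, Set.ncard_coe_finset, Nat.card_Icc]
    omega

end TreeDecomp

/-- Sweeping the prism one cycle at a time gives an ordering of bandwidth at most `m`. -/
theorem stackedPrism_exists_treeDecomp (m n : ℕ) (hm : 0 < m) (hn : 0 < n) :
    ∃ D : TreeDecomp (stackedPrism m n), ∀ t, (D.bag t).ncard ≤ m + 1 := by
  have hN : n * m = n * m - 1 + 1 := by have := Nat.mul_pos hn hm; omega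
  refine TreeDecomp.exists_of_bandwidth_le m
    (((Equiv.prodComm _ _).trans finProdFinEquiv).trans (finCongr hN)).toEmbedding ?_
  rintro ⟨i, j⟩ ⟨i', j'⟩ h
  simp only [stackedPrism, boxProd_adj, pathGraph_adj] at h
  simp only [Equiv.toEmbedding_apply, Equiv.trans_apply, Equiv.prodComm_apply, Prod.swap_prod_mk,
    finCongr_apply, Fin.val_cast, finProdFinEquiv_apply_val]
  rcases h with ⟨-, rfl⟩ | ⟨h, rfl⟩
  · omega
  · have : m * (j' : ℕ) ≤ m * j + m := by
      rw [← Nat.mul_succ]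
      exact Nat.mul_le_mul_left m (by omega)
    omega

/-- The vertices of the stacked prism in column `i`, or in row `j` away from column `x`. -/
def prismCross {m n : ℕ} (i x : Fin m) (j : Fin n) : Set (Fin m × Fin n) :=
  {v | v.1 = i} ∪ {v | v.2 = j ∧ v.1 ≠ x}

theorem prismCross_connected {m n : ℕ} {i x : Fin m} (hix : i ≠ x) (j : Fin n) :
    ((stackedPrism m n).induce (prismCross i x j)).Connected := by
  obtain ⟨m, rfl⟩ : ∃ k, m = k + 2 := ⟨m - 2, by have := Fin.val_ne_iff.2 hix; omega⟩
  obtain ⟨n, rfl⟩ : ∃ k, n = k + 1 := ⟨n - 1, by have := j.pos; omega⟩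
  have hcol := (pathGraph_connected n).induce_range
    (boxProdRight (cycleGraph (m + 2)) (pathGraph (n + 1)) i).toHom
  have hrow := (cycleGraph_induce_compl_singleton_connected m x).induce_image
    (boxProdLeft (cycleGraph (m + 2)) (pathGraph (n + 1)) j).toHom
  have h : prismCross i x j =
      Set.range (boxProdRight (cycleGraph (m + 2)) (pathGraph (n + 1)) i).toHom ∪
        (boxProdLeft (cycleGraph (m + 2)) (pathGraph (n + 1)) j).toHom '' {x}ᶜ := by
    ext ⟨a, b⟩
    simp [prismCross, boxProdLeft, boxProdRight, eq_comm, and_comm]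
  rw [h]
  exact induce_union_connected hcol.preconnected hrow.preconnected
    ⟨(i, j), ⟨j, rfl⟩, ⟨i, hix, rfl⟩⟩

theorem prismCross_touch {m n : ℕ} {i x i' x' : Fin m} (hix : i ≠ x)
    (j j' : Fin n) : ∃ a ∈ prismCross i x j, ∃ b ∈ prismCross i' x' j',
      a = b ∨ (stackedPrism m n).Adj a b := by
  by_cases h : i = x'
  · by_cases h' : i' = x
    · subst h h'
      obtain ⟨m, rfl⟩ : ∃ k, m = k + 2 := ⟨m - 2, by have := Fin.val_ne_iff.2 hix; omega⟩
      refine ⟨(i' + 1, j), Or.inr ⟨rfl, by simp⟩, (i', j), Or.inl rfl, Or.inr ?_⟩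
      exact boxProd_adj_left.2 (cycleGraph_adj.2 (Or.inl (by simp)))
    · exact ⟨(i', j), Or.inr ⟨rfl, h'⟩, (i', j), Or.inl rfl, Or.inl rfl⟩
  · exact ⟨(i, j'), Or.inl rfl, (i, j'), Or.inr ⟨rfl, h⟩, Or.inl rfl⟩

/-- Fewer than `2n` vertices miss some cross, since they miss a column entirely and meet some
row at most once. -/
theorem exists_prismCross_disjoint {n : ℕ} (hn : 0 < n) (S : Finset (Fin (2 * n) × Fin n))
    (hS : S.card < 2 * n) :
    ∃ i x j, i ≠ x ∧ Disjoint (S : Set (Fin (2 * n) × Fin n)) (prismCross i x j) := by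
  classical
  obtain ⟨i, hi⟩ : ∃ i, i ∉ S.image Prod.fst := by
    by_contra! h
    have h1 := Finset.card_le_card (fun i _ => h i : Finset.univ ⊆ S.image Prod.fst)
    have h2 : (S.image Prod.fst).card ≤ S.card := Finset.card_image_le
    rw [Finset.card_univ, Fintype.card_fin] at h1
    omega
  have hi' : ∀ v ∈ S, v.1 ≠ i := fun v hv h => hi (Finset.mem_image.2 ⟨v, hv, h⟩)
  obtain ⟨j, -, hj⟩ := Finset.exists_card_fiber_lt_of_card_lt_mul (s := S)
    (t := (Finset.univ : Finset (Fin n))) (f := Prod.snd) (n := 2)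
    (by rw [Finset.card_univ, Fintype.card_fin]; omega)
  obtain ⟨x, hix, hx⟩ : ∃ x, i ≠ x ∧ ∀ v ∈ S, v.2 = j → v.1 = x := by
    rcases (S.filter fun v => v.2 = j).eq_empty_or_nonempty with h | ⟨y, hy⟩
    · have : Nontrivial (Fin (2 * n)) := Fin.nontrivial_iff_two_le.2 (by omega)
      obtain ⟨x, hx⟩ := exists_ne i
      exact ⟨x, hx.symm, fun v hv hvj =>
        (Finset.eq_empty_iff_forall_notMem.1 h v (Finset.mem_filter.2 ⟨hv, hvj⟩)).elim⟩
    · refine ⟨y.1, (hi' y (Finset.mem_filter.1 hy).1).symm, fun v hv hvj => ?_⟩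
      rw [Finset.card_le_one.1 (Nat.le_of_lt_succ hj) v (Finset.mem_filter.2 ⟨hv, hvj⟩) y hy]
  refine ⟨i, x, j, hix, Set.disjoint_left.2 ?_⟩
  rintro v hv (h | ⟨h, h'⟩)
  · exact hi' v hv h
  · exact h' (hx v hv h)

theorem TreeDecomp.exists_le_ncard_bag_of_stackedPrism {n : ℕ} (hn : 0 < n)
    (D : TreeDecomp (stackedPrism (2 * n) n)) : ∃ t, 2 * n ≤ (D.bag t).ncard := by
  classical
  obtain ⟨t, ht⟩ := D.exists_isHittingSet_bag
    (ℬ := {B | ∃ i x j, i ≠ x ∧ B = prismCross i x j}) (Set.toFinite _)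
    (by rintro _ ⟨i, x, j, h, rfl⟩; exact prismCross_connected h j)
    (by rintro _ ⟨i, x, j, h, rfl⟩ _ ⟨i', x', j', -, rfl⟩; exact prismCross_touch h j j')
  refine ⟨t, ?_⟩
  by_contra! hlt
  rw [Set.ncard_eq_toFinset_card'] at hlt
  obtain ⟨i, x, j, hix, hdisj⟩ := exists_prismCross_disjoint hn _ hlt
  rw [Set.coe_toFinset, Set.disjoint_iff_inter_eq_empty] at hdisj
  exact (ht _ ⟨i, x, j, hix, rfl⟩).ne_empty hdisj

/-- For `n ≥ 2`, the treewidth of the stacked prism `Y_{2n,n}` satisfies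
`2n − 1 ≤ tw(Y_{2n,n}) ≤ 2n`. -/
theorem stackedPrism_treewidth_square (n : ℕ) (hn : 2 ≤ n) :
    2 * n - 1 ≤ treewidth (stackedPrism (2 * n) n) ∧
      treewidth (stackedPrism (2 * n) n) ≤ 2 * n := by
  have hupper := stackedPrism_exists_treeDecomp (2 * n) n (by omega) (by omega)
  refine ⟨le_csInf ⟨_, hupper⟩ ?_, Nat.sInf_le hupper⟩
  rintro k ⟨D, hD⟩
  obtain ⟨t, ht⟩ := D.exists_le_ncard_bag_of_stackedPrism (by omega)
  have := hD t
  omega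
end

section
/- Let G be a graph and k an integer. If tw(G) < k, then every bramble on G has order at most k; equivalently, for every bramble B on G there is a bag of any tree decomposition of G of minimum width that covers B, so the order of any bramble is at most tw(G) + 1. -/
open SimpleGraph

namespace SimpleGraph

variable {α : Type*} {T : SimpleGraph α}

/-- A vertex set is path-closed if it contains every vertex of each path joining two of its
members. -/
def PathClosed (T : SimpleGraph α) (S : Set α) : Prop :=
  ∀ ⦃x y : α⦄, x ∈ S → y ∈ S → ∀ p : T.Walk x y, p.IsPath → ∀ v ∈ p.support, v ∈ S

theorem PathClosed.inter {A B : Set α} (hA : T.PathClosed A) (hB : T.PathClosed B) :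
    T.PathClosed (A ∩ B) := fun _ _ hx hy p hp v hv =>
  ⟨hA hx.1 hy.1 p hp v hv, hB hx.2 hy.2 p hp v hv⟩

theorem IsAcyclic.mem_support_of_isPath (hT : T.IsAcyclic) {x y v : α} {p : T.Walk x y}
    (hp : p.IsPath) (q : T.Walk x y) (hv : v ∈ p.support) : v ∈ q.support := by
  classical
  have h : (⟨p, hp⟩ : T.Path x y) = ⟨q.bypass, q.bypass_isPath⟩ :=
    (hT.subsingleton_path x y).elim _ _
  rw [show p = q.bypass from congrArg Subtype.val h] at hv
  exact q.support_bypass_subset_support hv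

theorem IsAcyclic.pathClosed_of_preconnected (hT : T.IsAcyclic) {S : Set α}
    (hS : (T.induce S).Preconnected) : T.PathClosed S := by
  intro x y hx hy p hp v hv
  obtain ⟨q⟩ := hS ⟨x, hx⟩ ⟨y, hy⟩
  have h := hT.mem_support_of_isPath hp (q.map (Embedding.induce S).toHom) hv
  obtain ⟨w, -, rfl⟩ := List.mem_map.1 (Walk.support_map _ q ▸ h)
  exact w.2

theorem IsTree.inter_inter_nonempty (hT : T.IsTree) {A B C : Set α} (hA : T.PathClosed A)
    (hB : T.PathClosed B) (hC : T.PathClosed C) (hAB : (A ∩ B).Nonempty)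
    (hBC : (B ∩ C).Nonempty) (hAC : (A ∩ C).Nonempty) : (A ∩ B ∩ C).Nonempty := by
  obtain ⟨x, hxA, hxB⟩ := hAB
  obtain ⟨y, hyB, hyC⟩ := hBC
  obtain ⟨z, hzA, hzC⟩ := hAC
  obtain ⟨p, hp⟩ := (hT.connected x y).exists_isPath
  obtain ⟨q, hq⟩ := (hT.connected x z).exists_isPath
  obtain ⟨r, hr⟩ := (hT.connected z y).exists_isPath
  have hpB := hB hxB hyB p hp
  have hpAC : ∀ v ∈ p.support, v ∈ A ∨ v ∈ C := fun v hv => by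
    rcases (Walk.mem_support_append_iff _ _).1
      (hT.isAcyclic.mem_support_of_isPath hp (q.append r) hv) with h | h
    · exact .inl (hA hxA hzA q hq v h)
    · exact .inr (hC hzC hyC r hr v h)
  by_cases hyA : y ∈ A
  · exact ⟨y, ⟨hyA, hyB⟩, hyC⟩
  obtain ⟨d, hd, hdA, hdA'⟩ := p.exists_boundary_dart A hxA hyA
  have hdC := (hpAC _ (p.dart_snd_mem_support_of_mem_darts hd)).resolve_left hdA'
  obtain ⟨s, hs⟩ := (hT.connected z d.fst).exists_isPath
  have hsA := hA hzA hdA s hs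
  have hs' : (s.concat d.adj).IsPath := hs.concat (fun h => hdA' (hsA _ h)) d.adj
  refine ⟨d.fst, ⟨hdA, hpB _ (p.dart_fst_mem_support_of_mem_darts hd)⟩,
    hC hzC hdC _ hs' _ ?_⟩
  simp [Walk.support_concat]

/-- The Helly property of subtrees of a tree. -/
theorem IsTree.exists_mem_forall_of_pairwise_inter_nonempty (hT : T.IsTree) {β : Type*}
    {s : Finset β} (hs : s.Nonempty) (f : β → Set α) (hf : ∀ i ∈ s, T.PathClosed (f i))
    (hinter : ∀ i ∈ s, ∀ j ∈ s, (f i ∩ f j).Nonempty) : ∃ t, ∀ i ∈ s, t ∈ f i := by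
  induction hs using Finset.Nonempty.cons_induction generalizing f with
  | singleton a =>
    obtain ⟨t, ht, -⟩ := hinter a (by simp) a (by simp)
    exact ⟨t, by simpa using ht⟩
  | cons a s ha hs ih =>
    simp only [Finset.forall_mem_cons] at hf hinter
    obtain ⟨t, ht⟩ := ih (fun i => f i ∩ f a) (fun i hi => (hf.2 i hi).inter hf.1)
      (fun i hi j hj => by
        have h := hT.inter_inter_nonempty (hf.2 i hi) (hf.2 j hj) hf.1
          ((hinter.2 i hi).2 j hj) (hinter.2 j hj).1 (hinter.2 i hi).1
        rwa [Set.inter_inter_distrib_right] at h)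
    obtain ⟨i, hi⟩ := hs
    exact ⟨t, Finset.forall_mem_cons _ _ |>.2 ⟨(ht i hi).2, fun j hj => (ht j hj).1⟩⟩

end SimpleGraph

section

variable {V : Type*} {G : SimpleGraph V}

theorem TreeDecomp.preconnected_induce_hitting (D : TreeDecomp G) {B : Set V}
    (hB : (G.induce B).Preconnected) :
    (D.tree.induce {t | (D.bag t ∩ B).Nonempty}).Preconnected := by
  have key : ∀ u : B, ∀ s t, ∀ hs : u.1 ∈ D.bag s, ∀ ht : u.1 ∈ D.bag t,
      (D.tree.induce {t | (D.bag t ∩ B).Nonempty}).Reachable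
        ⟨s, u.1, hs, u.2⟩ ⟨t, u.1, ht, u.2⟩ := fun u s t hs ht =>
    ((D.bag_conn u).preconnected ⟨s, hs⟩ ⟨t, ht⟩).map
      (induceHomOfLE D.tree (s := {t | u.1 ∈ D.bag t})
        (s' := {t | (D.bag t ∩ B).Nonempty}) (fun _ h => ⟨u.1, h, u.2⟩)).toHom
  rintro ⟨s, u, hus, hu⟩ ⟨t, v, hvt, hv⟩
  obtain ⟨p⟩ := hB ⟨u, hu⟩ ⟨v, hv⟩
  generalize hu' : (⟨u, hu⟩ : B) = u' at p
  generalize hv' : (⟨v, hv⟩ : B) = v' at p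
  induction p generalizing s u with
  | nil =>
    obtain rfl : u = v := congrArg Subtype.val (hu'.trans hv'.symm)
    exact key ⟨u, hu⟩ s t hus hvt
  | @cons _ w _ h p ih =>
    subst hu'
    obtain ⟨r, hur, hwr⟩ := D.bag_edge h
    exact (key ⟨u, hu⟩ s r hus hur).trans (ih r w.1 hwr w.2 rfl hv')

theorem TreeDecomp.exists_bag_of_touches (D : TreeDecomp G) {A B : Set V} (hA : A.Nonempty)
    (hB : B.Nonempty) (h : Touches G A B) :
    ∃ t, (D.bag t ∩ A).Nonempty ∧ (D.bag t ∩ B).Nonempty := by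
  obtain ⟨a, ha⟩ := hA
  obtain ⟨b, hb⟩ := hB
  by_cases hbA : b ∈ A
  · obtain ⟨t, ht⟩ := D.bag_cover b
    exact ⟨t, ⟨b, ht, hbA⟩, ⟨b, ht, hb⟩⟩
  obtain ⟨p⟩ := h.preconnected ⟨a, .inl ha⟩ ⟨b, .inr hb⟩
  obtain ⟨d, -, hdA, hdA'⟩ := p.exists_boundary_dart {x | x.1 ∈ A} ha hbA
  obtain ⟨t, h₁, h₂⟩ := D.bag_edge d.adj
  exact ⟨t, ⟨_, h₁, hdA⟩, ⟨_, h₂, d.snd.2.resolve_left hdA'⟩⟩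

theorem IsBramble.nonempty_of_mem {ℬ : Set (Set V)} (h : IsBramble G ℬ) {B : Set V}
    (hB : B ∈ ℬ) : B.Nonempty :=
  Set.nonempty_coe_sort.1 (h.conn B hB).nonempty

/-- Some bag of a tree decomposition covers any given finite bramble. -/
theorem TreeDecomp.exists_isHittingSet_bag_s4 (D : TreeDecomp G) {ℬ : Set (Set V)}
    (h : IsBramble G ℬ) (hfin : ℬ.Finite) : ∃ t, IsHittingSet ℬ (D.bag t) := by
  rcases ℬ.eq_empty_or_nonempty with rfl | hne
  · obtain ⟨t⟩ := D.isTree.connected.nonempty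
    exact ⟨t, fun B hB => hB.elim⟩
  obtain ⟨t, ht⟩ := D.isTree.exists_mem_forall_of_pairwise_inter_nonempty
    (s := hfin.toFinset) (by simpa using hne) (fun B => {t | (D.bag t ∩ B).Nonempty})
    (fun B hB => D.isTree.isAcyclic.pathClosed_of_preconnected
      (D.preconnected_induce_hitting (h.conn B (by simpa using hB)).preconnected))
    (fun A hA B hB => by
      rw [Set.Finite.mem_toFinset] at hA hB
      exact D.exists_bag_of_touches (h.nonempty_of_mem hA) (h.nonempty_of_mem hB)
        (h.touch A hA B hB))
  exact ⟨t, fun B hB => ht B (by simpa using hB)⟩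

/-- The tree decomposition with a single bag. -/
def TreeDecomp.trivial (G : SimpleGraph V) : TreeDecomp G where
  ι := Unit
  tree := ⊥
  isTree := .of_subsingleton
  bag _ := Set.univ
  bag_cover _ := ⟨(), Set.mem_univ _⟩
  bag_edge _ _ _ := ⟨(), Set.mem_univ _, Set.mem_univ _⟩
  bag_conn _ := { preconnected := .of_subsingleton, nonempty := ⟨⟨(), Set.mem_univ _⟩⟩ }

theorem exists_treeDecomp_ncard_le_treewidth (G : SimpleGraph V) :
    ∃ D : TreeDecomp G, ∀ t, (D.bag t).ncard ≤ treewidth G + 1 :=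
  Nat.sInf_mem (s := {k : ℕ | ∃ D : TreeDecomp G, ∀ t, (D.bag t).ncard ≤ k + 1})
    ⟨(Set.univ : Set V).ncard, TreeDecomp.trivial G, fun _ => Nat.le_succ _⟩

end

/-- If `tw(G) < k`, then every bramble on `G` has order at most `k`. -/
theorem brambleOrder_le_of_treewidth_lt {V : Type} [Fintype V] (G : SimpleGraph V)
    (hG : G.Connected) (k : ℕ) (htw : treewidth G < k)
    (ℬ : Set (Set V)) (hB : IsBramble G ℬ) :
    brambleOrder ℬ ≤ k := by
  obtain ⟨D, hD⟩ := exists_treeDecomp_ncard_le_treewidth G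
  obtain ⟨t, ht⟩ := D.exists_isHittingSet_bag_s4 hB ℬ.toFinite
  have h : brambleOrder ℬ ≤ (D.bag t).ncard := Nat.sInf_le ⟨D.bag t, ht, rfl⟩
  exact h.trans ((hD t).trans htw)
end

section
/- For every n ≥ 1, the strict bramble number of the complete graph K_n equals ⌈n/2⌉. -/
open SimpleGraph

theorem SimpleGraph.induce_top_connected {V : Type*} {s : Set V} (hs : s.Nonempty) :
    ((⊤ : SimpleGraph V).induce s).Connected := by
  have : Nonempty s := hs.to_subtype
  rw [SimpleGraph.induce_top]
  exact SimpleGraph.connected_top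

theorem isStrictBramble_top {V : Type*} {ℬ : Set (Set V)}
    (h : ∀ A ∈ ℬ, ∀ B ∈ ℬ, (A ∩ B).Nonempty) : IsStrictBramble (⊤ : SimpleGraph V) ℬ := by
  have ne : ∀ A ∈ ℬ, A.Nonempty := fun A hA => (h A hA A hA).left
  exact ⟨⟨fun A hA => induce_top_connected (ne A hA),
    fun A hA _ _ => induce_top_connected (ne A hA).inl⟩, h⟩

theorem brambleOrder_le {V : Type*} {ℬ : Set (Set V)} {S : Set V} (hS : IsHittingSet ℬ S) :
    brambleOrder ℬ ≤ S.ncard :=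
  Nat.sInf_le ⟨S, hS, rfl⟩

/-- Any set of vertices either hits an intersecting family, or its complement contains a member
of the family, which is then itself a hitting set. -/
theorem IsStrictBramble.brambleOrder_le_half {V : Type*} [Finite V] {G : SimpleGraph V}
    {ℬ : Set (Set V)} (h : IsStrictBramble G ℬ) : brambleOrder ℬ ≤ (Nat.card V + 1) / 2 := by
  obtain ⟨S, -, hS⟩ := Set.exists_subset_card_eq (s := (Set.univ : Set V))
    (n := (Nat.card V + 1) / 2) (by rw [Set.ncard_univ]; omega)
  by_cases hit : IsHittingSet ℬ S
  · exact (brambleOrder_le hit).trans_eq hS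
  · simp only [IsHittingSet, not_forall, Set.not_nonempty_iff_eq_empty] at hit
    obtain ⟨B, hB, hSB⟩ := hit
    have hsub : B ⊆ Sᶜ := (Set.disjoint_iff_inter_eq_empty.mpr hSB).subset_compl_left
    have hcard := Set.ncard_le_ncard hsub
    have hcompl := Set.ncard_add_ncard_compl S
    have := brambleOrder_le (h.2 B hB)
    omega

theorem isStrictBramble_top_large {V : Type*} [Finite V] :
    IsStrictBramble (⊤ : SimpleGraph V) {B | Nat.card V / 2 < B.ncard} := by
  refine isStrictBramble_top fun A hA B hB => ?_
  rw [Set.mem_ofPred_eq] at hA hB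
  by_contra hAB
  have hdisj := Set.disjoint_iff_inter_eq_empty.mpr (Set.not_nonempty_iff_eq_empty.mp hAB)
  have hunion := Set.ncard_union_eq hdisj
  have hle := Set.ncard_le_card (A ∪ B)
  omega

theorem half_le_brambleOrder_large {V : Type*} [Finite V] [Nonempty V] :
    (Nat.card V + 1) / 2 ≤ brambleOrder {B : Set V | Nat.card V / 2 < B.ncard} := by
  refine le_csInf ⟨_, Set.univ, fun B hB => ?_, rfl⟩ ?_
  · rw [Set.univ_inter]
    exact Set.nonempty_of_ncard_ne_zero (Nat.ne_zero_of_lt hB)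
  · rintro _ ⟨S, hS, rfl⟩
    have hcompl := Set.ncard_add_ncard_compl S
    by_contra! hlt
    have hmem : Nat.card V / 2 < (Sᶜ).ncard := by omega
    simpa using hS Sᶜ hmem

theorem strictBrambleNumber_top {V : Type*} [Finite V] [Nonempty V] :
    strictBrambleNumber (⊤ : SimpleGraph V) = (Nat.card V + 1) / 2 := by
  refine IsGreatest.csSup_eq ⟨⟨_, isStrictBramble_top_large, ?_⟩, ?_⟩
  · exact isStrictBramble_top_large.brambleOrder_le_half.antisymm half_le_brambleOrder_large
  · rintro _ ⟨ℬ, hℬ, rfl⟩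
    exact hℬ.brambleOrder_le_half

/-- For `n ≥ 1`, the strict bramble number of the complete graph `K_n` is `⌈n/2⌉`. -/
theorem strictBrambleNumber_completeGraph (n : ℕ) (hn : 1 ≤ n) :
    strictBrambleNumber (⊤ : SimpleGraph (Fin n)) = (n + 1) / 2 := by
  have : Nonempty (Fin n) := ⟨⟨0, hn⟩⟩
  rw [strictBrambleNumber_top, Nat.card_fin]
end

section
/- If m ≥ 3 and n ≥ 1 with 2n < m, then the stacked prism graph Y_{m,n} admits a strict bramble of order 2n, namely the family B_1 of all sets consisting of one column with a single vertex deleted together with two full rows neither of which meets the column at the deleted vertex; in particular sbn(Y_{m,n}) ≥ 2n. -/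
open SimpleGraph

/-- A homomorphic image of a connected graph induces a connected subgraph. -/
theorem connected_induce_range_hom {V W : Type*} {H : SimpleGraph W} {G : SimpleGraph V}
    (f : H →g G) (hH : H.Connected) : (G.induce (Set.range f)).Connected := by
  have := hH.nonempty
  let g : H →g G.induce (Set.range f) :=
    ⟨fun w => ⟨f w, w, rfl⟩, fun {_ _} h => f.map_adj h⟩
  have : Nonempty (Set.range f) := ⟨⟨_, Classical.arbitrary W, rfl⟩⟩
  refine ⟨hH.preconnected.map g ?_⟩
  rintro ⟨_, w, rfl⟩
  exact ⟨w, rfl⟩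

theorem connected_induce_stackedPrism_row {m n : ℕ} (hn : 1 ≤ n) (r : Fin m) :
    ((stackedPrism m n).induce {v | v.1 = r}).Connected := by
  obtain ⟨k, rfl⟩ := Nat.exists_eq_add_of_le' hn
  let f : pathGraph (k + 1) →g stackedPrism m (k + 1) :=
    ⟨fun c => (r, c), fun {_ _} h => by simpa [stackedPrism, boxProd_adj] using h⟩
  have hf : Set.range f = {v | v.1 = r} := by
    ext ⟨a, b⟩
    simp [f, eq_comm]
  exact hf ▸ connected_induce_range_hom f (pathGraph_connected k)

theorem connected_induce_stackedPrism_column_diff {m n : ℕ} (hm : 3 ≤ m) (c : Fin n)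
    (d : Fin m) :
    ((stackedPrism m n).induce ({v | v.2 = c} \ {(d, c)})).Connected := by
  obtain ⟨k, rfl⟩ := Nat.exists_eq_add_of_le' hm
  have hsucc (i j : Fin (k + 2)) (h : i.val + 1 = j.val) : j.succ - i.succ = 1 := by
    rw [sub_eq_iff_eq_add]
    have : j.castSucc = i.succ := Fin.ext h.symm
    rw [← this]
    exact Fin.coeSucc_eq_succ.symm.trans (add_comm (j.castSucc : Fin (k + 3)) 1)
  let f : pathGraph (k + 2) →g stackedPrism (k + 3) n :=
    ⟨fun i => (d + i.succ, c), fun {i j} h => by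
      refine boxProd_adj.2 (Or.inl ⟨cycleGraph_adj.2 ?_, rfl⟩)
      rw [add_sub_add_left_eq_sub, add_sub_add_left_eq_sub]
      exact (pathGraph_adj.1 h).symm.imp (hsucc _ _) (hsucc _ _)⟩
  have hf : Set.range f = {v | v.2 = c} \ {(d, c)} := by
    ext ⟨a, b⟩
    constructor
    · rintro ⟨i, hi⟩
      obtain ⟨rfl, rfl⟩ := Prod.mk.inj hi
      simp [Fin.succ_ne_zero]
    · rintro ⟨rfl, hb⟩
      have hne : a - d ≠ 0 := fun h => hb (by simp [sub_eq_zero.1 h])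
      obtain ⟨i, hi⟩ := Fin.exists_succ_eq.2 hne
      exact ⟨i, Prod.ext ((congrArg (d + ·) hi).trans (add_sub_cancel d a)) rfl⟩
  exact hf ▸ connected_induce_range_hom f (pathGraph_connected (k + 1))

/-- The sets formed by a column minus one vertex and two full rows avoiding that vertex. -/
def prismBramble (m n : ℕ) : Set (Set (Fin m × Fin n)) :=
  {B | ∃ (c : Fin n) (d r₁ r₂ : Fin m), r₁ ≠ r₂ ∧ d ≠ r₁ ∧ d ≠ r₂ ∧
    B = ({v : Fin m × Fin n | v.2 = c} \ {(d, c)}) ∪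
      {v : Fin m × Fin n | v.1 = r₁} ∪ {v : Fin m × Fin n | v.1 = r₂}}

theorem isStrictBramble_prismBramble {m n : ℕ} (hm : 3 ≤ m) (hn : 1 ≤ n) :
    IsStrictBramble (stackedPrism m n) (prismBramble m n) := by
  have hconn : ∀ B ∈ prismBramble m n, ((stackedPrism m n).induce B).Connected := by
    rintro _ ⟨c, d, r₁, r₂, -, h₁, h₂, rfl⟩
    refine induce_union_connected (induce_union_connected
      (connected_induce_stackedPrism_column_diff hm c d).preconnected
      (connected_induce_stackedPrism_row hn r₁).preconnected
      ⟨(r₁, c), ?_⟩).preconnected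
      (connected_induce_stackedPrism_row hn r₂).preconnected ⟨(r₂, c), ?_⟩
    · simp [h₁.symm]
    · simp [h₂.symm]
  have hinter : ∀ A ∈ prismBramble m n, ∀ B ∈ prismBramble m n, (A ∩ B).Nonempty := by
    rintro _ ⟨c, d, r₁, r₂, hr, -, -, rfl⟩ _ ⟨c', d', r₁', r₂', -, -, -, rfl⟩
    rcases eq_or_ne r₁ d' with rfl | h
    · exact ⟨(r₂, c'), by simp, by simp [hr.symm]⟩
    · exact ⟨(r₁, c'), by simp, by simp [h]⟩
  exact ⟨⟨hconn, fun A hA B hB => induce_union_connected (hconn A hA).preconnected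
    (hconn B hB).preconnected (hinter A hA B hB)⟩, hinter⟩

/-- The first two rows form a hitting set, as no column minus a vertex avoids them. -/
theorem isHittingSet_prismBramble {m n : ℕ} (hm : 2 ≤ m) :
    IsHittingSet (prismBramble m n)
      ({⟨0, by lia⟩, ⟨1, by lia⟩} ×ˢ Set.univ : Set (Fin m × Fin n)) := by
  rintro _ ⟨c, d, r₁, r₂, -, -, -, rfl⟩
  by_cases h : d = ⟨0, by lia⟩
  · exact ⟨(⟨1, by lia⟩, c), by simp, by simp [h]⟩
  · exact ⟨(⟨0, by lia⟩, c), by simp, by simp [Ne.symm h]⟩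

theorem two_mul_le_ncard_of_isHittingSet_prismBramble {m n : ℕ} (hm : 3 ≤ m)
    (hmn : 2 * n < m) {S : Set (Fin m × Fin n)} (hS : IsHittingSet (prismBramble m n) S) :
    2 * n ≤ S.ncard := by
  classical
  by_contra! hlt
  obtain ⟨T, rfl⟩ := S.toFinite.exists_finset_coe
  rw [Set.ncard_coe_finset] at hlt
  obtain ⟨c, -, hc⟩ := Finset.exists_card_fiber_lt_of_card_lt_mul
    (s := T) (t := Finset.univ) (f := Prod.snd) (n := 2) (by simpa [mul_comm] using hlt)
  have hrows : 1 < ((T.image Prod.fst)ᶜ).card := by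
    have := T.card_image_le (f := Prod.fst)
    rw [Finset.card_compl, Fintype.card_fin]
    lia
  obtain ⟨r₁, hr₁, r₂, hr₂, hr⟩ := Finset.one_lt_card.1 hrows
  have hmiss {r} (hr : r ∈ (T.image Prod.fst)ᶜ) (v) (hv : v ∈ T) : v.1 ≠ r := by
    rintro rfl
    exact Finset.mem_compl.1 hr (Finset.mem_image_of_mem _ hv)
  obtain ⟨d, hd₁, hd₂, hd⟩ : ∃ d, d ≠ r₁ ∧ d ≠ r₂ ∧ ∀ v ∈ T, v.2 = c → v = (d, c) := by
    rcases (T.filter (fun v => v.2 = c)).eq_empty_or_nonempty with h | ⟨w, hw⟩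
    · obtain ⟨d, hd⟩ : ∃ d, d ∉ ({r₁, r₂} : Finset (Fin m)) := by
        by_contra! h
        have := Finset.card_le_card (fun x _ => h x : Finset.univ ⊆ ({r₁, r₂} : Finset (Fin m)))
        have := Finset.card_le_two (a := r₁) (b := r₂)
        simp only [Finset.card_univ, Fintype.card_fin] at *
        lia
      simp only [Finset.mem_insert, Finset.mem_singleton, not_or] at hd
      exact ⟨d, hd.1, hd.2, fun v hv hvc =>
        absurd (Finset.mem_filter.2 ⟨hv, hvc⟩) (h ▸ Finset.notMem_empty v)⟩
    · obtain ⟨hwT, hwc⟩ := Finset.mem_filter.1 hw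
      refine ⟨w.1, hmiss hr₁ w hwT, hmiss hr₂ w hwT, fun v hv hvc => ?_⟩
      rw [Finset.card_le_one.1 (Nat.lt_succ_iff.1 hc) v (Finset.mem_filter.2 ⟨hv, hvc⟩) w hw,
        ← hwc]
  obtain ⟨v, hv, (⟨hvc, hvd⟩ | hv₁) | hv₂⟩ := hS _ ⟨c, d, r₁, r₂, hr, hd₁, hd₂, rfl⟩
  · exact hvd (hd v hv hvc)
  · exact hmiss hr₁ v hv hv₁
  · exact hmiss hr₂ v hv hv₂

theorem brambleOrder_prismBramble {m n : ℕ} (hm : 3 ≤ m) (hmn : 2 * n < m) :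
    brambleOrder (prismBramble m n) = 2 * n := by
  have hcard : ({⟨0, by lia⟩, ⟨1, by lia⟩} ×ˢ Set.univ : Set (Fin m × Fin n)).ncard = 2 * n := by
    rw [Set.ncard_prod, Set.ncard_pair (by simp), Set.ncard_univ, Nat.card_fin]
  have hmem : 2 * n ∈ {k | ∃ S, IsHittingSet (prismBramble m n) S ∧ S.ncard = k} :=
    ⟨_, isHittingSet_prismBramble (by lia), hcard⟩
  refine le_antisymm (Nat.sInf_le hmem) (le_csInf ⟨_, hmem⟩ ?_)
  rintro _ ⟨S, hS, rfl⟩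
  exact two_mul_le_ncard_of_isHittingSet_prismBramble hm hmn hS

theorem brambleOrder_le_card {V : Type*} {G : SimpleGraph V} {ℬ : Set (Set V)}
    (h : IsBramble G ℬ) : brambleOrder ℬ ≤ Nat.card V := by
  refine Nat.sInf_le ⟨Set.univ, fun B hB => ?_, Set.ncard_univ V⟩
  rw [Set.univ_inter]
  exact Set.nonempty_coe_sort.1 (h.conn B hB).nonempty

theorem brambleOrder_le_strictBrambleNumber {V : Type*} {G : SimpleGraph V} {ℬ : Set (Set V)}
    (h : IsStrictBramble G ℬ) : brambleOrder ℬ ≤ strictBrambleNumber G := by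
  refine le_csSup ⟨Nat.card V, ?_⟩ ⟨ℬ, h, rfl⟩
  rintro _ ⟨𝒜, h𝒜, rfl⟩
  exact brambleOrder_le_card h𝒜.1

/-- If `2n < m`, the family `B₁` on `Y_{m,n}` of all sets consisting of one column with a
single vertex deleted together with two full rows (neither meeting the column at the
deleted vertex) is a strict bramble of order `2n`; in particular `sbn(Y_{m,n}) ≥ 2n`. -/
theorem stackedPrism_strictBramble_of_two_n_lt (m n : ℕ) (hm : 3 ≤ m) (hn : 1 ≤ n)
    (hmn : 2 * n < m) :
    IsStrictBramble (stackedPrism m n)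
        {B | ∃ (c : Fin n) (d r₁ r₂ : Fin m), r₁ ≠ r₂ ∧ d ≠ r₁ ∧ d ≠ r₂ ∧
          B = ({v : Fin m × Fin n | v.2 = c} \ {(d, c)}) ∪
            {v : Fin m × Fin n | v.1 = r₁} ∪ {v : Fin m × Fin n | v.1 = r₂}} ∧
      brambleOrder
        {B | ∃ (c : Fin n) (d r₁ r₂ : Fin m), r₁ ≠ r₂ ∧ d ≠ r₁ ∧ d ≠ r₂ ∧
          B = ({v : Fin m × Fin n | v.2 = c} \ {(d, c)}) ∪
            {v : Fin m × Fin n | v.1 = r₁} ∪ {v : Fin m × Fin n | v.1 = r₂}} = 2 * n ∧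
      2 * n ≤ strictBrambleNumber (stackedPrism m n) := by
  have hB := isStrictBramble_prismBramble hm hn
  have hord := brambleOrder_prismBramble hm hmn
  exact ⟨hB, hord, hord ▸ brambleOrder_le_strictBrambleNumber hB⟩
end
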